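/- arXiv:2504.07547 — 2 statements merged into one kernel-verified Lean document; each statement's English description precedes it below -/
import Mathlib

section
/- Let J be a finite index set, and for each j ∈ J let c j ∈ ℝ, let R j be a symmetric positive definite p×p real matrix, T j a symmetric positive definite q×q real matrix, B j a real n×p matrix, E j a real n×q matrix, and p j ∈ ℝ^n a vector. Let β > 0, let Q be a real n×n matrix, λ > 0 a constant with λ‖δ‖² ≤ δ ⬝ᵥ Q.mulVec δ for all δ ∈ ℝ^n, and let δ ∈ ℝ^n. Define u j = ((c j)/2) • ((R j)⁻¹.mulVec ((B j)ᵀ.mulVec (p j))) and w j = -((c j)/(2β²)) • ((T j)⁻¹.mulVec ((E j)ᵀ.mulVec (p j))). Then: (i) -δ ⬝ᵥ Q.mulVec δ - ∑_{j∈J} ((u j) ⬝ᵥ (R j).mulVec (u j)) + β² ∑_{j∈J} ((w j) ⬝ᵥ (T j).mulVec (w j)) = -δ ⬝ᵥ Q.mulVec δ - ∑_{j∈J} ((c j)²/4) • ((p j) ⬝ᵥ ((B j) * (R j)⁻¹ * (B j)ᵀ - (1/β²) • ((E j) * (T j)⁻¹ * (E j)ᵀ)).mulVec (p j)); (ii)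 if moreover for every j ∈ J the matrix (B j) * (R j)⁻¹ * (B j)ᵀ - (1/β²) • ((E j) * (T j)⁻¹ * (E j)ᵀ) is positive semidefinite, then this quantity is ≤ -λ‖δ‖². -/
open Matrix Finset

/-- The quadratic form of an invertible `M` at `k • M⁻¹ Fᵀ x` is `k²` times the quadratic form of
`F M⁻¹ Fᵀ` at `x`. -/
theorem dotProduct_mulVec_smul_inv_mulVec_transpose {m n : Type*} [Fintype m] [DecidableEq m]
    [Fintype n] {M : Matrix m m ℝ} (hM : IsUnit M.det) (F : Matrix n m ℝ) (x : n → ℝ) (k : ℝ) :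
    (k • (M⁻¹ *ᵥ (Fᵀ *ᵥ x))) ⬝ᵥ (M *ᵥ (k • (M⁻¹ *ᵥ (Fᵀ *ᵥ x))))
      = k ^ 2 * (x ⬝ᵥ ((F * M⁻¹ * Fᵀ) *ᵥ x)) := by
  have h : M *ᵥ (M⁻¹ *ᵥ (Fᵀ *ᵥ x)) = Fᵀ *ᵥ x := by
    rw [mulVec_mulVec, mul_nonsing_inv _ hM, one_mulVec]
  have h' : (F * M⁻¹ * Fᵀ) *ᵥ x = F *ᵥ (M⁻¹ *ᵥ (Fᵀ *ᵥ x)) := by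
    simp only [mulVec_mulVec, Matrix.mul_assoc]
  rw [mulVec_smul, h, h', dotProduct_mulVec x F, ← mulVec_transpose, smul_dotProduct,
    dotProduct_smul, dotProduct_comm (Fᵀ *ᵥ x), smul_eq_mul, smul_eq_mul]
  ring

/-- The Lyapunov-difference computation in part 1 of Lemma 3: with the optimal control
policies `u j = (c j / 2) (R j)⁻¹ (B j)ᵀ (p j)` and worst-case disturbance policies
`w j = -(c j / (2β²)) (T j)⁻¹ (E j)ᵀ (p j)` substituted, the one-step difference
`-δᵀQδ - ∑ⱼ uⱼᵀ Rⱼ uⱼ + β² ∑ⱼ wⱼᵀ Tⱼ wⱼ` equals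
`-δᵀQδ - ∑ⱼ (cⱼ²/4) pⱼᵀ (Bⱼ Rⱼ⁻¹ Bⱼᵀ - (1/β²) Eⱼ Tⱼ⁻¹ Eⱼᵀ) pⱼ`, and under the
disturbance-attenuation condition (each `Bⱼ Rⱼ⁻¹ Bⱼᵀ - (1/β²) Eⱼ Tⱼ⁻¹ Eⱼᵀ` PSD)
is bounded above by `-λ‖δ‖²`. -/
theorem lyapunov_difference_cooperative {J : Type*} [Fintype J] {n p q : ℕ}
    (c : J → ℝ)
    (R : J → Matrix (Fin p) (Fin p) ℝ) (hR : ∀ j, (R j).PosDef)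
    (T : J → Matrix (Fin q) (Fin q) ℝ) (hT : ∀ j, (T j).PosDef)
    (B : J → Matrix (Fin n) (Fin p) ℝ)
    (E : J → Matrix (Fin n) (Fin q) ℝ)
    (pvec : J → (Fin n → ℝ))
    (β : ℝ) (hβ : 0 < β)
    (Q : Matrix (Fin n) (Fin n) ℝ) (lam : ℝ) (hlam : 0 < lam)
    (δ : EuclideanSpace ℝ (Fin n))
    (hQ : ∀ x : EuclideanSpace ℝ (Fin n), lam * ‖x‖ ^ 2 ≤ x ⬝ᵥ Q.mulVec x)
    (u : J → (Fin p → ℝ))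
    (hu : ∀ j, u j = (c j / 2) • ((R j)⁻¹.mulVec ((B j)ᵀ.mulVec (pvec j))))
    (w : J → (Fin q → ℝ))
    (hw : ∀ j, w j = -(c j / (2 * β ^ 2)) • ((T j)⁻¹.mulVec ((E j)ᵀ.mulVec (pvec j)))) :
    (-(δ ⬝ᵥ Q.mulVec δ) - ∑ j, (u j) ⬝ᵥ (R j).mulVec (u j)
        + β ^ 2 * ∑ j, (w j) ⬝ᵥ (T j).mulVec (w j)
      = -(δ ⬝ᵥ Q.mulVec δ)
        - ∑ j, ((c j) ^ 2 / 4)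
            • ((pvec j) ⬝ᵥ ((B j) * (R j)⁻¹ * (B j)ᵀ
                - (1 / β ^ 2) • ((E j) * (T j)⁻¹ * (E j)ᵀ)).mulVec (pvec j))) ∧
    ((∀ j, ((B j) * (R j)⁻¹ * (B j)ᵀ
        - (1 / β ^ 2) • ((E j) * (T j)⁻¹ * (E j)ᵀ)).PosSemidef) →
      -(δ ⬝ᵥ Q.mulVec δ) - ∑ j, (u j) ⬝ᵥ (R j).mulVec (u j)
          + β ^ 2 * ∑ j, (w j) ⬝ᵥ (T j).mulVec (w j)
        ≤ -lam * ‖δ‖ ^ 2) := by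
  have hdiff : -(δ ⬝ᵥ Q.mulVec δ) - ∑ j, (u j) ⬝ᵥ (R j).mulVec (u j)
        + β ^ 2 * ∑ j, (w j) ⬝ᵥ (T j).mulVec (w j)
      = -(δ ⬝ᵥ Q.mulVec δ)
        - ∑ j, ((c j) ^ 2 / 4)
            • ((pvec j) ⬝ᵥ ((B j) * (R j)⁻¹ * (B j)ᵀ
                - (1 / β ^ 2) • ((E j) * (T j)⁻¹ * (E j)ᵀ)).mulVec (pvec j)) := by
    rw [sub_add, Finset.mul_sum, ← Finset.sum_sub_distrib]
    congr 1
    refine Finset.sum_congr rfl fun j _ => ?_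
    rw [hu, hw,
      dotProduct_mulVec_smul_inv_mulVec_transpose (hR j).det_pos.ne'.isUnit,
      dotProduct_mulVec_smul_inv_mulVec_transpose (hT j).det_pos.ne'.isUnit,
      sub_mulVec, smul_mulVec, dotProduct_sub, dotProduct_smul, smul_eq_mul, smul_eq_mul]
    field_simp
    ring
  refine ⟨hdiff, fun hpsd => ?_⟩
  rw [hdiff]
  have hsum : 0 ≤ ∑ j, ((c j) ^ 2 / 4)
      • ((pvec j) ⬝ᵥ ((B j) * (R j)⁻¹ * (B j)ᵀ
          - (1 / β ^ 2) • ((E j) * (T j)⁻¹ * (E j)ᵀ)).mulVec (pvec j)) :=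
    Finset.sum_nonneg fun j _ =>
      mul_nonneg (by positivity) (by simpa using (hpsd j).dotProduct_mulVec_nonneg (pvec j))
  linarith [hQ δ]
end

section
/- Let W̃, W* , η ∈ ℝ^m be vectors, r ∈ ℝ, and α > 0. Define the temporal-difference error e = r + (W* + W̃) ⬝ᵥ η and the updated error vector W̃' = W̃ - (α·e) • η. Then (1/α)·(‖W̃'‖² - ‖W̃‖²) = (r + W* ⬝ᵥ η)² - (W̃ ⬝ᵥ η)² - (1 - α‖η‖²)·e², and consequently (1/α)·(‖W̃'‖² - ‖W̃‖²) ≤ 2r² + 2(W* ⬝ᵥ η)² - (W̃ ⬝ᵥ η)² - (1 - α‖η‖²)·e². -/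
open Matrix

/-- The critic network one-step Lyapunov-difference computation (equations (44)–(46) in
the proof of Theorem 3): with TD error `e = r + (W* + W̃) ⬝ᵥ η` and update
`W̃' = W̃ - (α e) • η`, one has
`(1/α)(‖W̃'‖² - ‖W̃‖²) = (r + W*⬝ᵥη)² - (W̃⬝ᵥη)² - (1 - α‖η‖²) e²`, and consequently
`(1/α)(‖W̃'‖² - ‖W̃‖²) ≤ 2r² + 2(W*⬝ᵥη)² - (W̃⬝ᵥη)² - (1 - α‖η‖²) e²`. -/
theorem critic_lyapunov_difference {m : ℕ}
    (Wtilde Wstar η : EuclideanSpace ℝ (Fin m)) (r α : ℝ) (hα : 0 < α)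
    (e : ℝ) (he : e = r + (Wstar + Wtilde) ⬝ᵥ η)
    (Wtilde' : EuclideanSpace ℝ (Fin m))
    (hW' : Wtilde' = Wtilde - (α * e) • η) :
    (1 / α) * (‖Wtilde'‖ ^ 2 - ‖Wtilde‖ ^ 2)
      = (r + Wstar ⬝ᵥ η) ^ 2 - (Wtilde ⬝ᵥ η) ^ 2
        - (1 - α * ‖η‖ ^ 2) * e ^ 2 ∧
    (1 / α) * (‖Wtilde'‖ ^ 2 - ‖Wtilde‖ ^ 2)
      ≤ 2 * r ^ 2 + 2 * (Wstar ⬝ᵥ η) ^ 2 - (Wtilde ⬝ᵥ η) ^ 2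
        - (1 - α * ‖η‖ ^ 2) * e ^ 2 := by
  have hdot (x y : EuclideanSpace ℝ (Fin m)) : x ⬝ᵥ y = inner ℝ x y := by
    rw [EuclideanSpace.inner_eq_star_dotProduct, star_trivial, dotProduct_comm]
  have he' : e = r + (inner ℝ Wstar η + inner ℝ Wtilde η) := by
    rw [he, hdot, inner_add_left]
  have key : (1 / α) * (‖Wtilde'‖ ^ 2 - ‖Wtilde‖ ^ 2)
      = (r + Wstar ⬝ᵥ η) ^ 2 - (Wtilde ⬝ᵥ η) ^ 2 - (1 - α * ‖η‖ ^ 2) * e ^ 2 := by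
    rw [hW', norm_sub_sq_real, real_inner_smul_right, norm_smul, mul_pow, Real.norm_eq_abs,
      sq_abs, hdot, hdot, he']
    field_simp
    ring
  refine ⟨key, ?_⟩
  rw [key]
  linarith [add_sq_le (a := r) (b := Wstar ⬝ᵥ η)]
end
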